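/- arXiv:1109.1214 — 3 statements merged into one kernel-verified Lean document; each statement's English description precedes it below -/
import Mathlib

section
/- Let μ⁰ ∈ ℝ^m_+, α > 0, and d⁰, d¹, …, d^{k−1} ∈ ℝ^m, and define μ^{l+1} = P_+(μ^l + α d^l) for l = 0, …, k−1. Then −Σ_{l=0}^{k−1} (μ^l)ᵀ d^l ≤ (‖μ⁰‖₂² − ‖μ^k‖₂²)/(2α) + (α/2) Σ_{l=0}^{k−1} ‖d^l‖₂². -/
/-- Projecting onto the nonnegative orthant does not increase the Euclidean norm. -/
theorem norm_sq_projected_step_le {ι : Type*} [Fintype ι] {α : ℝ} {x y v : EuclideanSpace ℝ ι}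
    (h : ∀ j, y j = max (x j + α * v j) 0) :
    ‖y‖ ^ 2 ≤ ‖x‖ ^ 2 + 2 * α * ∑ j, x j * v j + α ^ 2 * ‖v‖ ^ 2 := by
  simp only [EuclideanSpace.real_norm_sq_eq, Finset.mul_sum, ← Finset.sum_add_distrib]
  refine Finset.sum_le_sum fun j _ => ?_
  rw [h j]
  rcases max_cases (x j + α * v j) 0 with ⟨hj, _⟩ | ⟨hj, _⟩ <;> rw [hj] <;>
    nlinarith [sq_nonneg (x j + α * v j)]

/-- For the projected subgradient-type dual update
`μ^{l+1} = P₊(μ^l + α d^l)`, one has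
`−Σ_{l<k} (μ^l)ᵀ d^l ≤ (‖μ⁰‖² − ‖μ^k‖²)/(2α) + (α/2) Σ_{l<k} ‖d^l‖²`. -/
theorem stmt_1 {m : ℕ} (k : ℕ) (α : ℝ) (hα : 0 < α)
    (μ d : ℕ → EuclideanSpace ℝ (Fin m))
    (hμ0 : ∀ j, 0 ≤ μ 0 j)
    (hupd : ∀ l < k, ∀ j, μ (l + 1) j = max (μ l j + α * d l j) 0) :
    -∑ l ∈ Finset.range k, ∑ j, μ l j * d l j ≤
      (‖μ 0‖ ^ 2 - ‖μ k‖ ^ 2) / (2 * α) +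
        (α / 2) * ∑ l ∈ Finset.range k, ‖d l‖ ^ 2 := by
  induction k with
  | zero => simp
  | succ k ih =>
    have step := norm_sq_projected_step_le (hupd k k.lt_succ_self)
    have ih := ih fun l hl => hupd l (hl.trans k.lt_succ_self)
    have key : -∑ j, μ k j * d k j ≤
        (‖μ k‖ ^ 2 - ‖μ (k + 1)‖ ^ 2) / (2 * α) + α / 2 * ‖d k‖ ^ 2 := by
      rw [← sub_le_iff_le_add, le_div_iff₀ (by positivity)]
      linarith
    rw [Finset.sum_range_succ, Finset.sum_range_succ, mul_add]
    simp only [sub_div] at ih key ⊢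
    linarith
end

section
/- Proposition (cost decrease for the suboptimal MPC update): Assume strong duality q* = f* holds and ‖g(u)‖₂ ≤ L for all u ∈ Ω with L > 0. Let Δ > 0, set the step size α = Δ/L² and suboptimality ε = Δ/2, set μ⁰ = 0, and generate iterates for l = 0, …, k−1 (k ≥ 1) by choosing u^l ∈ Ω with L(u^l, μ^l) ≤ min_{u ∈ Ω} L(u, μ^l) + ε and setting μ^{l+1} = P_+(μ^l + α g(u^l)). Suppose ū ∈ Ω satisfies g(ū) ≤ 0, and suppose f_prev ∈ ℝ satisfies f_prev − f(ū) > Δ. Then the primal average û^k = (1/k) Σ_{l=0}^{k−1} u^l satisfies f(û^k) < f_prev. -/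
/-- The projected step does not increase the squared norm by more than the unprojected one. -/
theorem sum_sq_max_step_le {ι : Type*} [Fintype ι] (x y v : ι → ℝ) (α : ℝ)
    (h : ∀ j, y j = max (x j + α * v j) 0) :
    ∑ j, y j ^ 2 ≤ ∑ j, x j ^ 2 + 2 * α * ∑ j, x j * v j + α ^ 2 * ∑ j, v j ^ 2 := by
  rw [Finset.mul_sum, Finset.mul_sum, ← Finset.sum_add_distrib, ← Finset.sum_add_distrib]
  refine Finset.sum_le_sum fun j _ => ?_
  have hexp : x j ^ 2 + 2 * α * (x j * v j) + α ^ 2 * v j ^ 2 = (x j + α * v j) ^ 2 := by ring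
  rw [hexp, h j]
  rcases max_cases (x j + α * v j) 0 with ⟨h1, _⟩ | ⟨h1, _⟩
  · rw [h1]
  · rw [h1]
    nlinarith [sq_nonneg (x j + α * v j)]


/-- cost decrease for the suboptimal MPC update: under strong duality
`q* = f*` and the norm bound `‖g(u)‖₂ ≤ L` on `Ω`, with step size `α = Δ/L²`,
suboptimality `ε = Δ/2`, `μ⁰ = 0`, a feasible `ū ∈ Ω` with `g(ū) ≤ 0` and
`f_prev − f(ū) > Δ`, the primal average `û^k = (1/k)Σ_{l<k} u^l` satisfies
`f(û^k) < f_prev`. -/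
theorem stmt_11 {n m : ℕ}
    (Ω : Set (EuclideanSpace ℝ (Fin n)))
    (hne : Ω.Nonempty) (hcomp : IsCompact Ω) (hconv : Convex ℝ Ω)
    (f : EuclideanSpace ℝ (Fin n) → ℝ) (hf : ConvexOn ℝ Set.univ f)
    (g : EuclideanSpace ℝ (Fin n) → EuclideanSpace ℝ (Fin m))
    (hg : ∀ j, ConvexOn ℝ Set.univ (fun u => g u j))
    (Lag : EuclideanSpace ℝ (Fin n) → EuclideanSpace ℝ (Fin m) → ℝ)
    (hLag : ∀ u μ, Lag u μ = f u + ∑ j, μ j * g u j)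
    (q : EuclideanSpace ℝ (Fin m) → ℝ)
    (hq : ∀ μ, q μ = sInf ((fun u => Lag u μ) '' Ω))
    (qstar : ℝ) (hqstar : qstar = sSup (q '' {μ : EuclideanSpace ℝ (Fin m) | ∀ j, 0 ≤ μ j}))
    (fstar : ℝ)
    (hfstar : IsLeast (f '' {u ∈ Ω | ∀ j, g u j ≤ 0}) fstar)
    (hstrong : qstar = fstar)
    (Lb : ℝ) (hLbpos : 0 < Lb) (hLb : ∀ u ∈ Ω, ‖g u‖ ≤ Lb)
    (Δ : ℝ) (hΔ : 0 < Δ)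
    (α : ℝ) (hα : α = Δ / Lb ^ 2)
    (ε : ℝ) (hε : ε = Δ / 2)
    (k : ℕ) (hk : 1 ≤ k)
    (u : ℕ → EuclideanSpace ℝ (Fin n)) (μ : ℕ → EuclideanSpace ℝ (Fin m))
    (hμ0 : ∀ j, μ 0 j = 0)
    (hu : ∀ l < k, u l ∈ Ω)
    (happrox : ∀ l < k, Lag (u l) (μ l) ≤ q (μ l) + ε)
    (hupd : ∀ l < k, ∀ j, μ (l + 1) j = max (μ l j + α * g (u l) j) 0)
    (ubar : EuclideanSpace ℝ (Fin n)) (hubar : ubar ∈ Ω)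
    (hubar_feas : ∀ j, g ubar j ≤ 0)
    (fprev : ℝ) (hdec : fprev - f ubar > Δ) :
    f ((k : ℝ)⁻¹ • ∑ l ∈ Finset.range k, u l) < fprev := by
  have hfcont : Continuous f := by
    simpa [continuousOn_univ] using hf.continuousOn isOpen_univ
  have hgcont : ∀ j, Continuous fun u => g u j := fun j => by
    simpa [continuousOn_univ] using (hg j).continuousOn isOpen_univ
  have hweak : ∀ ν : EuclideanSpace ℝ (Fin m), (∀ j, 0 ≤ ν j) → q ν ≤ f ubar := by
    intro ν hν
    have hbdd : BddBelow ((fun u => Lag u ν) '' Ω) := by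
      apply hcomp.bddBelow_image
      simp only [hLag]
      exact (hfcont.add (continuous_finsetSum _ fun j _ =>
        continuous_const.mul (hgcont j))).continuousOn
    have hle : q ν ≤ Lag ubar ν := hq ν ▸ csInf_le hbdd ⟨ubar, hubar, rfl⟩
    have hsum : ∑ j, ν j * g ubar j ≤ 0 :=
      Finset.sum_nonpos fun j _ => mul_nonpos_of_nonneg_of_nonpos (hν j) (hubar_feas j)
    rw [hLag] at hle
    linarith
  have hμ : ∀ l ≤ k, ∀ j, 0 ≤ μ l j := by
    intro l hl j
    cases l with
    | zero => exact (hμ0 j).ge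
    | succ l => exact hupd l hl j ▸ le_max_right _ _
  have hαpos : 0 < α := hα ▸ by positivity
  have hαL : α * Lb ^ 2 = Δ := by rw [hα]; field_simp
  have hind : ∀ l ≤ k, 2 * α * ∑ i ∈ Finset.range l, f (u i) + ∑ j, μ l j ^ 2
      ≤ 2 * α * (l * (f ubar + Δ)) := by
    intro l
    induction l with
    | zero => simp [hμ0]
    | succ l ih =>
      intro hl
      have ih := ih (Nat.le_of_succ_le hl)
      have hstep := sum_sq_max_step_le (fun j => μ l j) (fun j => μ (l + 1) j)
        (fun j => g (u l) j) α (hupd l hl)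
      have hnorm : ∑ j, g (u l) j ^ 2 ≤ Lb ^ 2 := by
        rw [← EuclideanSpace.real_norm_sq_eq]
        exact pow_le_pow_left₀ (norm_nonneg _) (hLb _ (hu l hl)) 2
      have happ := happrox l hl
      rw [hLag] at happ
      have hdual := hweak (μ l) (hμ l (Nat.le_of_succ_le hl))
      have hsq : α ^ 2 * ∑ j, g (u l) j ^ 2 ≤ α * Δ :=
        calc α ^ 2 * ∑ j, g (u l) j ^ 2 ≤ α ^ 2 * Lb ^ 2 := by gcongr
          _ = α * Δ := by rw [← hαL]; ring
      have hval : α * (f (u l) + ∑ j, μ l j * g (u l) j) ≤ α * (f ubar + Δ / 2) :=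
        mul_le_mul_of_nonneg_left (by linarith) hαpos.le
      rw [Finset.sum_range_succ]
      push_cast
      linarith
  have hkpos : (0 : ℝ) < k := by exact_mod_cast hk
  have hsum : ∑ i ∈ Finset.range k, f (u i) ≤ k * (f ubar + Δ) := by
    have hfin := hind k le_rfl
    have hnn : 0 ≤ ∑ j, μ k j ^ 2 := Finset.sum_nonneg fun j _ => sq_nonneg _
    exact le_of_mul_le_mul_left (by linarith) (by positivity : 0 < 2 * α)
  have hjensen : f ((k : ℝ)⁻¹ • ∑ l ∈ Finset.range k, u l)
      ≤ (k : ℝ)⁻¹ * ∑ l ∈ Finset.range k, f (u l) := by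
    rw [Finset.smul_sum, Finset.mul_sum]
    exact hf.map_sum_le (fun _ _ => by positivity)
      (by simp [hkpos.ne']) (fun _ _ => Set.mem_univ _)
  calc f ((k : ℝ)⁻¹ • ∑ l ∈ Finset.range k, u l)
      ≤ (k : ℝ)⁻¹ * ∑ l ∈ Finset.range k, f (u l) := hjensen
    _ ≤ (k : ℝ)⁻¹ * (k * (f ubar + Δ)) := by gcongr
    _ = f ubar + Δ := by field_simp
    _ < fprev := by linarith
end

section
/- Lemma (shifted sequence is a Slater vector): Let A ∈ ℝ^{n×n}, B ∈ ℝ^{n×q}, K ∈ ℝ^{q×n}, and let X, X_f, U be subsets of ℝⁿ, ℝⁿ, ℝ^q respectively with X_f ⊆ X. Assume that for every x ∈ int(X_f): (A + BK)x ∈ int(X_f) and Kx ∈ int(U). Let N ≥ 2, let x_0 ∈ ℝⁿ and inputs u_0, …, u_{N−1} generate states by x_{k+1} = A x_k + B u_k, and suppose u_k ∈ int(U) for k = 0, …, N−1, x_k ∈ int(X) for k = 1, …, N−1, and x_N ∈ int(X_f). Define the shifted input sequence ũ_0 = u_1, …, ũ_{N−2} = u_{N−1}, ũ_{N−1} = K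 x_N, applied from the initial state x̃_0 = x_1, generating states x̃_{k+1} = A x̃_k + B ũ_k. Then ũ_k ∈ int(U) for k = 0, …, N−1, x̃_k ∈ int(X) for k = 1, …, N−1, and x̃_N ∈ int(X_f); that is, the shifted sequence is strictly feasible for the shifted horizon problem. -/
/-- shifted sequence is a Slater vector: if the interior of the terminal
set `X_f` is invariant under `x ↦ (A + BK)x` with `Kx ∈ int(U)` for `x ∈ int(X_f)`, and
the inputs `u_0, …, u_{N−1}` drive `x_0` through strictly feasible states
(`u_k ∈ int(U)`, `x_k ∈ int(X)` for `1 ≤ k ≤ N−1`, `x_N ∈ int(X_f)`), then the shifted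
input sequence `ũ_k = u_{k+1}` (`k ≤ N−2`), `ũ_{N−1} = K x_N`, applied from `x̃_0 = x_1`,
is strictly feasible for the shifted horizon problem. -/
theorem stmt_12 {n q : ℕ}
    (A : Matrix (Fin n) (Fin n) ℝ) (B : Matrix (Fin n) (Fin q) ℝ)
    (K : Matrix (Fin q) (Fin n) ℝ)
    (X Xf : Set (Fin n → ℝ)) (U : Set (Fin q → ℝ))
    (hXfX : Xf ⊆ X)
    (hinv : ∀ x ∈ interior Xf, (A + B * K).mulVec x ∈ interior Xf)
    (hKU : ∀ x ∈ interior Xf, K.mulVec x ∈ interior U)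
    (N : ℕ) (hN : 2 ≤ N)
    (x : ℕ → Fin n → ℝ) (u : ℕ → Fin q → ℝ)
    (hdyn : ∀ k < N, x (k + 1) = A.mulVec (x k) + B.mulVec (u k))
    (hu : ∀ k < N, u k ∈ interior U)
    (hx : ∀ k, 1 ≤ k → k ≤ N - 1 → x k ∈ interior X)
    (hxN : x N ∈ interior Xf)
    (ut : ℕ → Fin q → ℝ) (xt : ℕ → Fin n → ℝ)
    (hut : ∀ k < N - 1, ut k = u (k + 1))
    (hutN : ut (N - 1) = K.mulVec (x N))
    (hxt0 : xt 0 = x 1)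
    (hxtdyn : ∀ k < N, xt (k + 1) = A.mulVec (xt k) + B.mulVec (ut k)) :
    (∀ k < N, ut k ∈ interior U) ∧
      (∀ k, 1 ≤ k → k ≤ N - 1 → xt k ∈ interior X) ∧
      xt N ∈ interior Xf := by
  have hshift : ∀ k, k ≤ N - 1 → xt k = x (k + 1) := by
    intro k
    induction k with
    | zero => exact fun _ => hxt0
    | succ k ih =>
      intro hk
      rw [hxtdyn k (by omega), ih (by omega), hut k (by omega), hdyn (k + 1) (by omega)]
  have hN1 : N - 1 + 1 = N := by omega
  refine ⟨fun k hk => ?_, fun k _ hk => ?_, ?_⟩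
  · by_cases hlt : k < N - 1
    · rw [hut k hlt]
      exact hu _ (by omega)
    · obtain rfl : k = N - 1 := by omega
      rw [hutN]
      exact hKU _ hxN
  · rw [hshift k hk]
    by_cases hlt : k < N - 1
    · exact hx _ (by omega) (by omega)
    · obtain rfl : k = N - 1 := by omega
      rw [hN1]
      exact interior_mono hXfX hxN
  · have hlast := hxtdyn (N - 1) (by omega)
    rw [hshift (N - 1) le_rfl, hutN, hN1, Matrix.mulVec_mulVec, ← Matrix.add_mulVec] at hlast
    rw [hlast]
    exact hinv _ hxN
end
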